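/- Let u ∈ C_{+,log} be increasing and (log,x^k)-convex for some k > 0. Then for every a > 1 and every r ≥ 0, L_u(r) ≤ sqrt(ℓ_u(0) · ea/log a) · u(a·2^{k+1} r)^{1/2}. -/

import Mathlib

open Real Filter Set

/-- The Legendre transform `ℓ_u(t) = inf_{r>0} u(r)/r^t`. -/
noncomputable def legendreTransform (u : ℝ → ℝ) (t : ℝ) : ℝ :=
  ⨅ r : Set.Ioi (0:ℝ), u r / (r : ℝ) ^ t

/-- The L-function `L_u(r) = Σ_{n=0}^∞ ℓ_u(n) r^n`. -/
noncomputable def Lfunction (u : ℝ → ℝ) (r : ℝ) : ℝ :=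
  ∑' n : ℕ, legendreTransform u n * r ^ n

lemma legendre_bddBelow (u : ℝ → ℝ) (hpos : ∀ r ≥ (0:ℝ), 0 < u r) (t : ℝ) :
    BddBelow (Set.range (fun r : Set.Ioi (0:ℝ) => u r / (r : ℝ) ^ t)) := by
  refine ⟨0, ?_⟩
  rintro _ ⟨⟨x, hx⟩, rfl⟩
  have hx' : (0:ℝ) < x := hx
  exact div_nonneg (hpos x hx'.le).le (Real.rpow_nonneg hx'.le _)

lemma legendre_le (u : ℝ → ℝ) (hpos : ∀ r ≥ (0:ℝ), 0 < u r) (t s : ℝ) (hs : 0 < s) :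
    legendreTransform u t ≤ u s / s ^ t :=
  ciInf_le (legendre_bddBelow u hpos t) (⟨s, hs⟩ : Set.Ioi (0:ℝ))

lemma legendre_nonneg (u : ℝ → ℝ) (hpos : ∀ r ≥ (0:ℝ), 0 < u r) (t : ℝ) :
    0 ≤ legendreTransform u t := by
  refine Real.iInf_nonneg ?_
  rintro ⟨x, hx⟩
  have hx' : (0:ℝ) < x := hx
  exact div_nonneg (hpos x hx'.le).le (Real.rpow_nonneg hx'.le _)

lemma le_legendre_zero (u : ℝ → ℝ) (hmono : MonotoneOn u (Set.Ici 0)) :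
    u 0 ≤ legendreTransform u 0 := by
  haveI : Nonempty (Set.Ioi (0:ℝ)) := ⟨⟨1, Set.mem_Ioi.2 one_pos⟩⟩
  refine le_ciInf ?_
  rintro ⟨x, hx⟩
  have hx' : (0:ℝ) < x := hx
  simpa using hmono (Set.mem_Ici.2 le_rfl) (Set.mem_Ici.2 hx'.le) hx'.le

lemma legendre_zero_le (u : ℝ → ℝ) (hpos : ∀ r ≥ (0:ℝ), 0 < u r)
    (hcont : ContinuousOn u (Set.Ici 0)) : legendreTransform u 0 ≤ u 0 := by
  have h : Tendsto u (nhdsWithin 0 (Set.Ioi 0)) (nhds (u 0)) :=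
    (hcont 0 (Set.mem_Ici.2 le_rfl)).mono_left (nhdsWithin_mono _ Set.Ioi_subset_Ici_self)
  refine ge_of_tendsto h ?_
  filter_upwards [self_mem_nhdsWithin] with x hx
  simpa using legendre_le u hpos 0 x hx

/-- Let `u ∈ C_{+,log}` be increasing and (log,x^k)-convex for some `k > 0`.
Then for every `a > 1` and every `r ≥ 0`,
`L_u(r) ≤ sqrt(ℓ_u(0) · e a / log a) · u(a 2^{k+1} r)^{1/2}`. -/
theorem Lfunction_le_sqrt (u : ℝ → ℝ) (k : ℝ)
    (hk : 0 < k)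
    (hpos : ∀ r ≥ (0:ℝ), 0 < u r)
    (hcont : ContinuousOn u (Set.Ici 0))
    (hlog : Tendsto (fun r => Real.log (u r) / Real.log r) atTop atTop)
    (hmono : MonotoneOn u (Set.Ici 0))
    (hconv : ConvexOn ℝ (Set.Ici 0) (fun x => Real.log (u (x ^ k)))) :
    ∀ a > (1:ℝ), ∀ r ≥ (0:ℝ),
      Lfunction u r ≤ Real.sqrt (legendreTransform u 0 * (Real.exp 1 * a / Real.log a)) *
        Real.sqrt (u (a * (2:ℝ) ^ (k + 1) * r)) := by
  intro a ha r hr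
  have hu0 := le_legendre_zero u hmono
  have hu0p := hpos 0 le_rfl
  have hs0 : 0 ≤ 2 * a * r := by positivity
  have hU := hpos _ hs0
  have hterm : ∀ n : ℕ, legendreTransform u n * r ^ n ≤ u (2 * a * r) * (1 / 2 : ℝ) ^ n := by
    intro n
    rcases hr.eq_or_lt with h | h
    · subst h
      rcases n with _ | n
      · simpa using legendre_zero_le u hpos hcont
      · have : 0 ≤ u (2 * a * 0) * (1 / 2 : ℝ) ^ (n + 1) := by positivity
        simpa using this
    · have hs : 0 < 2 * a * r := by positivity
      have h1 := legendre_le u hpos n (2 * a * r) hs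
      rw [Real.rpow_natCast] at h1
      calc legendreTransform u n * r ^ n ≤ u (2 * a * r) / (2 * a * r) ^ n * r ^ n := by gcongr
        _ = u (2 * a * r) * (1 / (2 * a)) ^ n := by
          rw [mul_pow (2 * a) r n, div_pow, one_pow]
          field_simp
        _ ≤ u (2 * a * r) * (1 / 2 : ℝ) ^ n := by
          gcongr
          linarith
  have hgeo : Summable (fun n : ℕ => u (2 * a * r) * (1 / 2 : ℝ) ^ n) :=
    summable_geometric_two.mul_left _
  have hsum : Summable (fun n : ℕ => legendreTransform u n * r ^ n) :=
    Summable.of_nonneg_of_le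
      (fun n => mul_nonneg (legendre_nonneg u hpos n) (pow_nonneg hr n)) hterm hgeo
  have hL : Lfunction u r ≤ u (2 * a * r) * 2 := by
    have := hsum.tsum_le_tsum hterm hgeo
    rwa [tsum_mul_left, tsum_geometric_two] at this
  have hla : 0 < Real.log a := Real.log_pos ha
  have hC : 4 ≤ Real.exp 1 * a / Real.log a := by
    have h2 : (2:ℝ) ≤ Real.exp 1 := by linarith [Real.add_one_le_exp (1:ℝ)]
    have h3 : Real.log a ≤ a / Real.exp 1 := by
      have h4 := Real.log_le_sub_one_of_pos (x := a / Real.exp 1) (by positivity)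
      rw [Real.log_div (by positivity) (by positivity), Real.log_exp] at h4
      linarith
    rw [le_div_iff₀ (Real.exp_pos 1)] at h3
    rw [le_div_iff₀ hla]
    nlinarith
  -- midpoint convexity
  have hsq : u (2 * a * r) ^ 2 ≤ u 0 * u (a * (2:ℝ) ^ (k + 1) * r) := by
    set x := (2 * a * r) ^ (1 / k) with hx
    have hx0 : 0 ≤ x := Real.rpow_nonneg hs0 _
    have hxk : x ^ k = 2 * a * r := by
      rw [hx, ← Real.rpow_mul hs0, one_div_mul_cancel hk.ne', Real.rpow_one]
    have h2xk : (2 * x) ^ k = a * (2:ℝ) ^ (k + 1) * r := by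
      rw [Real.mul_rpow (by norm_num) hx0, hxk, Real.rpow_add_one (by norm_num)]
      ring
    have hW : 0 < u (a * (2:ℝ) ^ (k + 1) * r) := hpos _ (by positivity)
    have h := hconv.2 (Set.mem_Ici.2 (le_refl (0:ℝ)))
      (Set.mem_Ici.2 (by positivity : (0:ℝ) ≤ 2 * x))
      (by norm_num : (0:ℝ) ≤ 1 / 2) (by norm_num : (0:ℝ) ≤ 1 / 2) (by norm_num)
    have hmid : (1 / 2 : ℝ) • (0:ℝ) + (1 / 2 : ℝ) • (2 * x) = x := by
      simp only [smul_eq_mul]; ring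
    simp only [hmid] at h
    rw [hxk, h2xk, Real.zero_rpow hk.ne'] at h
    simp only [smul_eq_mul] at h
    rw [← Real.log_le_log_iff (by positivity) (by positivity), Real.log_pow,
      Real.log_mul hu0p.ne' hW.ne']
    push_cast
    linarith
  have hW : 0 < u (a * (2:ℝ) ^ (k + 1) * r) := hpos _ (by positivity)
  refine hL.trans ?_
  rw [← Real.sqrt_mul (mul_nonneg (hu0p.le.trans hu0) (by linarith))]
  refine Real.le_sqrt_of_sq_le ?_
  calc (u (2 * a * r) * 2) ^ 2 = u (2 * a * r) ^ 2 * 4 := by ring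
    _ ≤ u 0 * u (a * (2:ℝ) ^ (k + 1) * r) * 4 := by gcongr
    _ = u 0 * 4 * u (a * (2:ℝ) ^ (k + 1) * r) := by ring
    _ ≤ _ := by
      have hl0 : 0 ≤ legendreTransform u 0 := hu0p.le.trans hu0
      gcongr
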